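/- Let (B,W) be a polygonal coloring of the plane with boundary ∂ satisfying condition (C3). Let A be a feasible point and let d be an oriented boundary direction at A. Let u be a unit vector with A + u ∈ ∂, and let d' be an oriented boundary direction at A + u. If |⟨u, d⟩| < √3/2 (i.e., the segment from A to A+u forms an acute angle greater than π/6 with d), then d' = −d; if |⟨u, d⟩| > √3/2 (i.e., that acute angle is less than π/6), then d' = d. -/

import Mathlib

open scoped RealInnerProductSpace

noncomputable section

/-- `l` is an (affine) line in the plane: a nonempty one-dimensional affine subspace. -/
def IsLine (l : AffineSubspace ℝ (EuclideanSpace ℝ (Fin 2))) : Prop :=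
  (l : Set (EuclideanSpace ℝ (Fin 2))).Nonempty ∧ Module.finrank ℝ l.direction = 1

/-- A boundary segment: a closed convex subset of some affine line, containing
more than one point (it may be a segment, a ray, or a full line). -/
def IsSeg (s : Set (EuclideanSpace ℝ (Fin 2))) : Prop :=
  IsClosed s ∧ Convex ℝ s ∧ s.Nontrivial ∧
    ∃ l : AffineSubspace ℝ (EuclideanSpace ℝ (Fin 2)), IsLine l ∧ s ⊆ (l : Set _)

/-- `x` is an endpoint of the segment `s`: a point of `s` not in its relative
(intrinsic) interior. -/
def IsEndpoint (x : EuclideanSpace ℝ (Fin 2)) (s : Set (EuclideanSpace ℝ (Fin 2))) : Prop :=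
  x ∈ s ∧ x ∉ intrinsicInterior ℝ s

/-- The coloring `(B, Bᶜ)` is polygonal, with set of boundary segments `S`. -/
structure IsPolygonal (B : Set (EuclideanSpace ℝ (Fin 2)))
    (S : Set (Set (EuclideanSpace ℝ (Fin 2)))) : Prop where
  /-- The black points lie in the closure of the black interior. -/
  black_sub : B ⊆ closure (interior B)
  /-- The white points lie in the closure of the white interior. -/
  white_sub : Bᶜ ⊆ closure (interior Bᶜ)
  /-- Every member of `S` is a boundary segment. -/
  seg : ∀ s ∈ S, IsSeg s
  /-- The boundary of the coloring is the union of the boundary segments. -/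
  boundary : frontier B = ⋃₀ S
  /-- Two distinct boundary segments meet in at most one point. -/
  inter_subsingleton : ∀ s ∈ S, ∀ t ∈ S, s ≠ t → (s ∩ t).Subsingleton
  /-- A common point of two distinct boundary segments is an endpoint of both. -/
  inter_endpoint : ∀ s ∈ S, ∀ t ∈ S, s ≠ t → ∀ x ∈ s ∩ t, IsEndpoint x s ∧ IsEndpoint x t
  /-- No two distinct boundary segments sharing a common point lie on a common line. -/
  no_common_line : ∀ s ∈ S, ∀ t ∈ S, s ≠ t → (s ∩ t).Nonempty →
      ¬∃ l : AffineSubspace ℝ (EuclideanSpace ℝ (Fin 2)),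
        IsLine l ∧ s ⊆ (l : Set _) ∧ t ⊆ (l : Set _)
  /-- Every bounded region meets only finitely many boundary segments. -/
  loc_finite : ∀ R : Set (EuclideanSpace ℝ (Fin 2)), Bornology.IsBounded R →
      {s ∈ S | (s ∩ R).Nonempty}.Finite

/-- Condition (C3): every monochromatic unit triangle has a vertex on the boundary. -/
def C3 (B : Set (EuclideanSpace ℝ (Fin 2))) : Prop :=
  ∀ X Y Z : EuclideanSpace ℝ (Fin 2),
    dist X Y = 1 → dist Y Z = 1 → dist Z X = 1 →
    ((X ∈ B ∧ Y ∈ B ∧ Z ∈ B) ∨ (X ∉ B ∧ Y ∉ B ∧ Z ∉ B)) →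
    X ∈ frontier B ∨ Y ∈ frontier B ∨ Z ∈ frontier B

/-- `x` is a boundary vertex: an endpoint of some boundary segment. -/
def IsVertex (S : Set (Set (EuclideanSpace ℝ (Fin 2)))) (x : EuclideanSpace ℝ (Fin 2)) : Prop :=
  ∃ s ∈ S, IsEndpoint x s

/-- A boundary point `A` is feasible if it is not a boundary vertex and the unit
circle centered at `A` contains no boundary vertex. -/
def Feasible (B : Set (EuclideanSpace ℝ (Fin 2))) (S : Set (Set (EuclideanSpace ℝ (Fin 2))))
    (A : EuclideanSpace ℝ (Fin 2)) : Prop :=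
  A ∈ frontier B ∧ ¬IsVertex S A ∧ ∀ P ∈ Metric.sphere A 1, ¬IsVertex S P

/-- Two segments are parallel: any lines containing them have the same direction. -/
def SegParallel (s t : Set (EuclideanSpace ℝ (Fin 2))) : Prop :=
  ∀ l₁ l₂ : AffineSubspace ℝ (EuclideanSpace ℝ (Fin 2)),
    IsLine l₁ → IsLine l₂ → s ⊆ (l₁ : Set _) → t ⊆ (l₂ : Set _) →
    l₁.direction = l₂.direction

end

/-- The vector `d` rotated by `π/2` counterclockwise. -/
noncomputable def perpVec (d : EuclideanSpace ℝ (Fin 2)) : EuclideanSpace ℝ (Fin 2) :=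
  (WithLp.equiv 2 (Fin 2 → ℝ)).symm ![-(d 1), d 0]

/-- `d` is an oriented boundary direction at the (non-vertex) boundary point `p`:
near `p` the boundary lies on the line `p + ℝ·d`, with the white region (interior
of `Bᶜ`) on the left of `d` and the black region (interior of `B`) on the right. -/
def OrientedDir (B : Set (EuclideanSpace ℝ (Fin 2))) (p d : EuclideanSpace ℝ (Fin 2)) : Prop :=
  ‖d‖ = 1 ∧ ∃ ε : ℝ, 0 < ε ∧
    (∀ q ∈ frontier B ∩ Metric.ball p ε, ∃ t : ℝ, q = p + t • d) ∧
    ∀ t : ℝ, 0 < t → t < ε →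
      p + t • perpVec d ∈ interior Bᶜ ∧ p - t • perpVec d ∈ interior B

noncomputable section

open Real

section

open Filter Topology

/-- The Euclidean plane. -/
abbrev Plane := EuclideanSpace ℝ (Fin 2)

theorem inner_eq_coord (x y : Plane) : ⟪x, y⟫ = x 0 * y 0 + x 1 * y 1 := by
  simp [PiLp.inner_apply, Fin.sum_univ_two, mul_comm]

@[simp] theorem perpVec_zero (d : Plane) : perpVec d 0 = -(d 1) := rfl

@[simp] theorem perpVec_one (d : Plane) : perpVec d 1 = d 0 := rfl

theorem norm_eq_one_iff_coord (x : Plane) : ‖x‖ = 1 ↔ x 0 ^ 2 + x 1 ^ 2 = 1 := by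
  rw [EuclideanSpace.norm_eq, Real.sqrt_eq_one]
  simp [Fin.sum_univ_two]

theorem plane_ext {x y : Plane} (h0 : x 0 = y 0) (h1 : x 1 = y 1) : x = y := by
  ext i
  fin_cases i
  · exact h0
  · exact h1

/-- The combination `v / 2 + s v⊥`; if `s² = 3/4` this is the rotation by `±π/3`. -/
def rot (s : ℝ) (v : Plane) : Plane := (1 / 2 : ℝ) • v + s • perpVec v

/-- The rotation of `v` by the angle `t`. -/
def arc (v : Plane) (t : ℝ) : Plane := cos t • v + sin t • perpVec v

@[simp] theorem rot_zero_coord (s : ℝ) (v : Plane) : rot s v 0 = 1 / 2 * v 0 - s * v 1 := by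
  simp [rot]; ring

@[simp] theorem rot_one_coord (s : ℝ) (v : Plane) : rot s v 1 = 1 / 2 * v 1 + s * v 0 := by
  simp [rot]

@[simp] theorem arc_zero_coord (v : Plane) (t : ℝ) : arc v t 0 = cos t * v 0 - sin t * v 1 := by
  simp [arc]; ring

@[simp] theorem arc_one_coord (v : Plane) (t : ℝ) : arc v t 1 = cos t * v 1 + sin t * v 0 := by
  simp [arc]

@[simp] theorem arc_zero (v : Plane) : arc v 0 = v := by simp [arc]

theorem continuous_arc (v : Plane) : Continuous (arc v) := by
  unfold arc; fun_prop

theorem rot_arc (s : ℝ) (v : Plane) (t : ℝ) : rot s (arc v t) = arc (rot s v) t := by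
  apply plane_ext <;> simp <;> ring

theorem norm_rot {s : ℝ} (hs : s ^ 2 = 3 / 4) {v : Plane} (hv : ‖v‖ = 1) : ‖rot s v‖ = 1 := by
  rw [norm_eq_one_iff_coord] at *
  simp only [rot_zero_coord, rot_one_coord]
  linear_combination (1 / 4 + s ^ 2) * hv + hs

theorem norm_arc {v : Plane} (hv : ‖v‖ = 1) (t : ℝ) : ‖arc v t‖ = 1 := by
  rw [norm_eq_one_iff_coord] at *
  simp only [arc_zero_coord, arc_one_coord]
  linear_combination (cos t ^ 2 + sin t ^ 2) * hv + sin_sq_add_cos_sq t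

theorem norm_sub_rot {s : ℝ} (hs : s ^ 2 = 3 / 4) {v : Plane} (hv : ‖v‖ = 1) :
    ‖v - rot s v‖ = 1 := by
  rw [norm_eq_one_iff_coord] at *
  simp only [PiLp.sub_apply, rot_zero_coord, rot_one_coord]
  linear_combination (1 / 4 + s ^ 2) * hv + hs

theorem C3.compl {B : Set Plane} (h : C3 B) : C3 Bᶜ := by
  intro X Y Z hXY hYZ hZX hm
  rw [frontier_compl]
  refine h X Y Z hXY hYZ hZX ?_
  simpa [or_comm] using hm

theorem notMem_frontier_of_mem_interior {B : Set Plane} {x : Plane} (h : x ∈ interior B) :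
    x ∉ frontier B := fun h' => h'.2 h

theorem C3.not_mono {B : Set Plane} (h : C3 B) {A v : Plane} {s : ℝ}
    (hA : A ∈ closure (interior B)) (hv : ‖v‖ = 1) (hs : s ^ 2 = 3 / 4)
    (h1 : A + v ∈ interior B) (h2 : A + rot s v ∈ interior B) : False := by
  have e1 : ∀ᶠ x in 𝓝 A, x + v ∈ interior B :=
    (continuous_add_const v).continuousAt.eventually_mem (isOpen_interior.mem_nhds h1)
  have e2 : ∀ᶠ x in 𝓝 A, x + rot s v ∈ interior B :=
    (continuous_add_const _).continuousAt.eventually_mem (isOpen_interior.mem_nhds h2)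
  obtain ⟨x, hx, hx1, hx2⟩ := ((mem_closure_iff_frequently.1 hA).and_eventually (e1.and e2)).exists
  have := h x (x + v) (x + rot s v) (by simp [hv])
    (by rw [dist_add_left, dist_eq_norm, norm_sub_rot hs hv]) (by simp [norm_rot hs hv])
    (Or.inl ⟨interior_subset hx, interior_subset hx1, interior_subset hx2⟩)
  rcases this with h | h | h
  · exact notMem_frontier_of_mem_interior hx h
  · exact notMem_frontier_of_mem_interior hx1 h
  · exact notMem_frontier_of_mem_interior hx2 h

/-- Near `p` the boundary of the coloring is the line through `p` orthogonal to `n`, with the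
white region on the side of `n`. -/
def LocalHalf (B : Set Plane) (p n : Plane) : Prop :=
  ∀ᶠ q in 𝓝 p, (0 < ⟪q - p, n⟫ → q ∈ interior Bᶜ) ∧ (⟪q - p, n⟫ < 0 → q ∈ interior B) ∧
    (⟪q - p, n⟫ = 0 → q ∈ frontier B)

/-- Either `p` is not a boundary point, or the boundary is a line near `p`. -/
def Regular (B : Set Plane) (p : Plane) : Prop :=
  p ∉ frontier B ∨ ∃ n, n ≠ 0 ∧ LocalHalf B p n

variable {B : Set Plane} {A p v n : Plane} {s : ℝ}

theorem LocalHalf.compl (h : LocalHalf B p n) : LocalHalf Bᶜ p (-n) := by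
  filter_upwards [h] with q hq
  simp only [inner_neg_right, compl_compl, frontier_compl]
  exact ⟨fun h => hq.2.1 (by linarith), fun h => hq.1 (by linarith), fun h => hq.2.2 (by linarith)⟩

theorem Regular.compl (h : Regular B p) : Regular Bᶜ p := by
  rcases h with h | ⟨n, hn, h⟩
  · left; rwa [frontier_compl]
  · exact Or.inr ⟨-n, neg_ne_zero.2 hn, h.compl⟩

theorem LocalHalf.mem_frontier (h : LocalHalf B p n) : p ∈ frontier B :=
  h.self_of_nhds.2.2 (by simp)

theorem LocalHalf.eventually (h : LocalHalf B p n) :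
    ∀ᶠ q in 𝓝 p, ⟪q - p, n⟫ = 0 → LocalHalf B q n := by
  filter_upwards [eventually_eventually_nhds.2 h] with q hq h0
  filter_upwards [hq] with r hr
  have : ⟪r - q, n⟫ = ⟪r - p, n⟫ := by
    rw [← sub_sub_sub_cancel_right r q p, inner_sub_left, h0, sub_zero]
  rwa [this]

theorem Regular.eventually (h : Regular B p) : ∀ᶠ q in 𝓝 p, Regular B q := by
  rcases h with h | ⟨n, hn, h⟩
  · filter_upwards [isClosed_frontier.isOpen_compl.mem_nhds h] with q hq using Or.inl hq
  · filter_upwards [h, h.eventually] with q hq hq'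
    rcases lt_trichotomy ⟪q - p, n⟫ 0 with h0 | h0 | h0
    · exact Or.inl (notMem_frontier_of_mem_interior (hq.2.1 h0))
    · exact Or.inr ⟨n, hn, hq' h0⟩
    · left
      rw [← frontier_compl]
      exact notMem_frontier_of_mem_interior (hq.1 h0)

theorem tendsto_add_smul (p n : Plane) : Tendsto (fun t : ℝ => p + t • n) (𝓝[>] 0) (𝓝 p) := by
  have : Continuous fun t : ℝ => p + t • n := by fun_prop
  simpa using (this.tendsto 0).mono_left nhdsWithin_le_nhds

theorem inner_self_pos_of_ne_zero (hn : n ≠ 0) : 0 < ⟪n, n⟫ := real_inner_self_pos.2 hn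

theorem LocalHalf.eventually_white (h : LocalHalf B p n) {m : Plane} (hm : 0 < ⟪m, n⟫) :
    ∀ᶠ t : ℝ in 𝓝[>] 0, p + t • m ∈ interior Bᶜ := by
  filter_upwards [(tendsto_add_smul p m).eventually h, self_mem_nhdsWithin] with t ht ht0
  refine ht.1 ?_
  rw [add_sub_cancel_left, real_inner_smul_left]
  exact mul_pos ht0 hm

theorem LocalHalf.mem_closure_white (h : LocalHalf B p n) (hn : n ≠ 0) :
    p ∈ closure (interior Bᶜ) :=
  mem_closure_of_tendsto (tendsto_add_smul p n)
    (h.eventually_white (inner_self_pos_of_ne_zero hn))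

theorem LocalHalf.mem_closure_black (h : LocalHalf B p n) (hn : n ≠ 0) :
    p ∈ closure (interior B) := by
  simpa using h.compl.mem_closure_white (neg_ne_zero.2 hn)

theorem tendsto_arc (A v : Plane) : Tendsto (fun t => A + arc v t) (𝓝 0) (𝓝 (A + v)) := by
  have h : Continuous fun t => A + arc v t := continuous_const.add (continuous_arc v)
  simpa only [arc_zero] using h.tendsto 0

theorem inner_arc_sub (A v n : Plane) (t : ℝ) : ⟪A + arc v t - (A + v), n⟫ =
    2 * sin (t / 2) * (cos (t / 2) * ⟪perpVec v, n⟫ - sin (t / 2) * ⟪v, n⟫) := by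
  have h1 : sin t = 2 * sin (t / 2) * cos (t / 2) := by rw [← sin_two_mul]; ring_nf
  have h2 : cos t = 1 - 2 * sin (t / 2) ^ 2 := by
    rw [← cos_two_mul_eq_one_sub]; ring_nf
  simp only [inner_eq_coord, PiLp.sub_apply, PiLp.add_apply, arc_zero_coord, arc_one_coord,
    perpVec_zero, perpVec_one, h1, h2]
  ring

theorem eventually_sin_half_pos : ∀ᶠ t : ℝ in 𝓝[>] 0, 0 < sin (t / 2) := by
  filter_upwards [Ioo_mem_nhdsGT (show (0 : ℝ) < 2 by norm_num)] with t ht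
  exact sin_pos_of_pos_of_lt_pi (by linarith [ht.1]) (by linarith [ht.2, pi_gt_three])

theorem eventually_sin_half_neg : ∀ᶠ t : ℝ in 𝓝[<] 0, sin (t / 2) < 0 := by
  filter_upwards [Ioo_mem_nhdsLT (show (-2 : ℝ) < 0 by norm_num)] with t ht
  exact sin_neg_of_neg_of_neg_pi_lt (by linarith [ht.2]) (by linarith [ht.1, pi_gt_three])

theorem eventually_factor_pos (v : Plane) {n : Plane} (h : 0 < ⟪perpVec v, n⟫) :
    ∀ᶠ t : ℝ in 𝓝 0, 0 < cos (t / 2) * ⟪perpVec v, n⟫ - sin (t / 2) * ⟪v, n⟫ := by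
  have : Continuous fun t : ℝ => cos (t / 2) * ⟪perpVec v, n⟫ - sin (t / 2) * ⟪v, n⟫ := by
    fun_prop
  exact this.continuousAt.eventually (lt_mem_nhds (by simpa using h))

theorem LocalHalf.arc_transversal (h : LocalHalf B (A + v) n) (hv : 0 < ⟪perpVec v, n⟫) :
    (∀ᶠ t in 𝓝[>] 0, A + arc v t ∈ interior Bᶜ) ∧ ∀ᶠ t in 𝓝[<] 0, A + arc v t ∈ interior B := by
  have e := ((tendsto_arc A v).eventually h).and (eventually_factor_pos v hv)
  constructor
  · filter_upwards [e.filter_mono nhdsWithin_le_nhds, eventually_sin_half_pos] with t ht hs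
    refine ht.1.1 ?_
    rw [inner_arc_sub]
    exact mul_pos (by linarith) ht.2
  · filter_upwards [e.filter_mono nhdsWithin_le_nhds, eventually_sin_half_neg] with t ht hs
    refine ht.1.2.1 ?_
    rw [inner_arc_sub]
    exact mul_neg_of_neg_of_pos (by linarith) ht.2

theorem LocalHalf.arc_tangent (h : LocalHalf B (A + v) n) (hv : ⟪perpVec v, n⟫ = 0)
    (hv' : ⟪v, n⟫ < 0) : ∀ᶠ t in 𝓝[≠] 0, A + arc v t ∈ interior Bᶜ := by
  have hs : ∀ᶠ t : ℝ in 𝓝[≠] 0, sin (t / 2) ≠ 0 := by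
    rw [← nhdsLT_sup_nhdsGT, eventually_sup]
    exact ⟨eventually_sin_half_neg.mono fun _ => ne_of_lt,
      eventually_sin_half_pos.mono fun _ => ne_of_gt⟩
  filter_upwards [((tendsto_arc A v).eventually h).filter_mono nhdsWithin_le_nhds, hs] with t ht hs
  refine ht.1 ?_
  rw [inner_arc_sub, hv]
  have : 0 < sin (t / 2) ^ 2 := by positivity
  nlinarith

theorem eq_zero_of_inner_eq_zero (hv : v ≠ 0) (h : ⟪v, n⟫ = 0) (h' : ⟪perpVec v, n⟫ = 0) :
    n = 0 := by
  have h2 : ⟪v, v⟫ ≠ 0 := inner_self_ne_zero.2 hv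
  rw [inner_eq_coord] at h h' h2
  simp only [perpVec_zero, perpVec_one] at h'
  apply plane_ext <;> apply mul_left_cancel₀ h2
  · simp only [PiLp.zero_apply]
    linear_combination v 0 * h - v 1 * h'
  · simp only [PiLp.zero_apply]
    linear_combination v 1 * h + v 0 * h'

theorem mem_interior_of_notMem_frontier (h : p ∉ frontier B) :
    p ∈ interior Bᶜ ∨ p ∈ interior B := by
  by_contra hc
  rw [not_or, interior_compl, Set.mem_compl_iff, not_not] at hc
  exact h hc

theorem Regular.arc_color (h : Regular B (A + v)) (hv : v ≠ 0) {F : Filter ℝ}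
    (hF : F = 𝓝[>] 0 ∨ F = 𝓝[<] 0) :
    (∀ᶠ t in F, A + arc v t ∈ interior Bᶜ) ∨ ∀ᶠ t in F, A + arc v t ∈ interior B := by
  have hF0 : F ≤ 𝓝 0 := by rcases hF with rfl | rfl <;> exact nhdsWithin_le_nhds
  have hF1 : F ≤ 𝓝[≠] 0 := by
    rw [← nhdsLT_sup_nhdsGT]
    rcases hF with rfl | rfl
    exacts [le_sup_right, le_sup_left]
  rcases h with h | ⟨n, hn, h⟩
  · refine (mem_interior_of_notMem_frontier h).imp (fun hi => ?_) fun hi => ?_ <;>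
    exact ((tendsto_arc A v).eventually_mem (isOpen_interior.mem_nhds hi)).filter_mono hF0
  · rcases lt_trichotomy ⟪perpVec v, n⟫ 0 with h0 | h0 | h0
    · have := h.compl.arc_transversal (by rw [inner_neg_right]; linarith)
      rw [compl_compl] at this
      rcases hF with rfl | rfl
      exacts [Or.inr this.1, Or.inl this.2]
    · have h1 : ⟪v, n⟫ ≠ 0 := fun h1 => hn (eq_zero_of_inner_eq_zero hv h1 h0)
      rcases lt_or_gt_of_ne h1 with h1 | h1
      · exact Or.inl ((h.arc_tangent h0 h1).filter_mono hF1)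
      · have := h.compl.arc_tangent (by rw [inner_neg_right, h0, neg_zero])
          (by rw [inner_neg_right]; linarith)
        rw [compl_compl] at this
        exact Or.inr (this.filter_mono hF1)
    · have := h.arc_transversal h0
      rcases hF with rfl | rfl
      exacts [Or.inl this.1, Or.inr this.2]

theorem ne_zero_of_norm_eq_one (hv : ‖v‖ = 1) : v ≠ 0 := by
  rintro rfl
  simp at hv

/-- Along the unit circle around a boundary point, colors alternate under rotation by `π/3`. -/
theorem C3.alternate (hC : C3 B) (hA : A ∈ closure (interior Bᶜ)) (hv : ‖v‖ = 1)
    (hs : s ^ 2 = 3 / 4) (hr : Regular B (A + rot s v)) {F : Filter ℝ}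
    (hF : F = 𝓝[>] 0 ∨ F = 𝓝[<] 0) (h : ∀ᶠ t in F, A + arc v t ∈ interior Bᶜ) :
    ∀ᶠ t in F, A + arc (rot s v) t ∈ interior B := by
  refine (hr.arc_color (ne_zero_of_norm_eq_one (norm_rot hs hv)) hF).resolve_left fun h' => ?_
  have : F.NeBot := by rcases hF with rfl | rfl <;> infer_instance
  obtain ⟨t, ht, ht'⟩ := (h.and h').exists
  rw [← rot_arc] at ht'
  exact hC.compl.not_mono hA (norm_arc hv t) hs ht ht'

theorem disjoint_interior_compl {x : Plane} (h : x ∈ interior B) (h' : x ∈ interior Bᶜ) : False :=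
  interior_subset h' (interior_subset h)

theorem LocalHalf.color_change (h : LocalHalf B (A + v) n)
    (hb : ∀ᶠ t in 𝓝[>] 0, A + arc v t ∈ interior B) : ⟪perpVec v, n⟫ ≤ 0 := by
  by_contra! h0
  obtain ⟨t, ht, ht'⟩ := (hb.and (h.arc_transversal h0).1).exists
  exact disjoint_interior_compl ht ht'

theorem C3.cross_pos (hC : C3 B) (hW : A ∈ closure (interior Bᶜ)) (hB : A ∈ closure (interior B))
    (hv : ‖v‖ = 1) (hs : s ^ 2 = 3 / 4) (hr : Regular B (A + rot s v))
    (h : LocalHalf B (A + v) n) (hn : 0 < ⟪perpVec v, n⟫) :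
    ∃ m, m ≠ 0 ∧ LocalHalf B (A + rot s v) m ∧ ⟪perpVec (rot s v), m⟫ < 0 := by
  obtain ⟨h1, h2⟩ := h.arc_transversal hn
  have b1 := hC.alternate hW hv hs hr (Or.inl rfl) h1
  have b2 := hC.compl.alternate (by rwa [compl_compl]) hv hs hr.compl (Or.inr rfl)
    (by rwa [compl_compl])
  have hw : rot s v ≠ 0 := ne_zero_of_norm_eq_one (norm_rot hs hv)
  have tt := tendsto_arc A (rot s v)
  rcases hr with hr | ⟨m, hm0, hm⟩
  · exfalso
    rcases mem_interior_of_notMem_frontier hr with hi | hi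
    · obtain ⟨t, ht, ht'⟩ := (b1.and ((tt.eventually_mem (isOpen_interior.mem_nhds hi)).filter_mono
        nhdsWithin_le_nhds)).exists
      exact disjoint_interior_compl ht ht'
    · obtain ⟨t, ht, ht'⟩ := (b2.and ((tt.eventually_mem (isOpen_interior.mem_nhds hi)).filter_mono
        nhdsWithin_le_nhds)).exists
      exact disjoint_interior_compl ht' ht
  · refine ⟨m, hm0, hm, lt_of_le_of_ne (hm.color_change b1) fun h0 => ?_⟩
    have h1 : ⟪rot s v, m⟫ ≠ 0 := fun h1 => hm0 (eq_zero_of_inner_eq_zero hw h1 h0)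
    rcases lt_or_gt_of_ne h1 with h1 | h1
    · obtain ⟨t, ht, ht'⟩ := (b1.and ((hm.arc_tangent h0 h1).filter_mono
        (nhdsWithin_mono _ fun t ht => ne_of_gt ht))).exists
      exact disjoint_interior_compl ht ht'
    · have := hm.compl.arc_tangent (by rw [inner_neg_right, h0, neg_zero])
        (by rw [inner_neg_right]; linarith)
      rw [compl_compl] at this
      obtain ⟨t, ht, ht'⟩ := (b2.and (this.filter_mono
        (nhdsWithin_mono _ fun t ht => ne_of_lt ht))).exists
      exact disjoint_interior_compl ht' ht

/-- If the unit circle around a boundary point crosses the boundary transversally at `A + v`, it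
does so in the opposite sense at the point rotated by `π/3`. -/
theorem C3.cross (hC : C3 B) (hW : A ∈ closure (interior Bᶜ)) (hB : A ∈ closure (interior B))
    (hv : ‖v‖ = 1) (hs : s ^ 2 = 3 / 4) (hr : Regular B (A + rot s v))
    (h : LocalHalf B (A + v) n) (hn : ⟪perpVec v, n⟫ ≠ 0) :
    ∃ m, m ≠ 0 ∧ LocalHalf B (A + rot s v) m ∧
      ⟪perpVec v, n⟫ * ⟪perpVec (rot s v), m⟫ < 0 := by
  rcases lt_or_gt_of_ne hn with h0 | h0
  · obtain ⟨m, hm0, hm, hlt⟩ := hC.compl.cross_pos (by rwa [compl_compl]) hW hv hs hr.compl h.compl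
      (by rw [inner_neg_right]; linarith)
    refine ⟨-m, neg_ne_zero.2 hm0, by simpa using hm.compl, ?_⟩
    rw [inner_neg_right]
    nlinarith
  · obtain ⟨m, hm0, hm, hlt⟩ := hC.cross_pos hW hB hv hs hr h h0
    exact ⟨m, hm0, hm, mul_neg_of_pos_of_neg h0 hlt⟩

theorem tendsto_add_smul_arc (A v d : Plane) {f : ℝ → ℝ} (hf : ContinuousAt f 0) (hf0 : f 0 = 0) :
    Tendsto (fun t => A + f t • d) (𝓝 0) (𝓝 A) ∧
    Tendsto (fun t => A + f t • d + arc v t) (𝓝 0) (𝓝 (A + v)) := by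
  have h1 : Tendsto (fun t => A + f t • d) (𝓝 0) (𝓝 A) := by
    have : ContinuousAt (fun t => A + f t • d) 0 := by fun_prop
    simpa [ContinuousAt, hf0] using this
  refine ⟨h1, h1.add ?_⟩
  simpa using (continuous_arc v).tendsto 0

theorem C3.parallel_aux (hC : C3 B) {d e : Plane} (hA : LocalHalf B A e) (he : e ≠ 0)
    (hd : ⟪d, e⟫ = 0) (hv : ‖v‖ = 1) (h : LocalHalf B (A + v) n) (hn : ⟪perpVec v, n⟫ ≠ 0)
    (hs : s ^ 2 = 3 / 4) (hr : Regular B (A + rot s v)) (ha : ⟪d, n⟫ ≠ 0) :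
    ⟪d, rot s n⟫ = ⟪d, n⟫ := by
  obtain ⟨m, hm0, hm, -⟩ := hC.cross (hA.mem_closure_white he) (hA.mem_closure_black he) hv hs hr h hn
  set f : ℝ → ℝ := fun t => ⟪v - arc v t, n⟫ / ⟪d, n⟫ with hf
  have hfc : Continuous f := by
    have := continuous_arc v
    fun_prop
  have hf0 : f 0 = 0 := by simp [hf]
  obtain ⟨t1, t2⟩ := tendsto_add_smul_arc A v d hfc.continuousAt hf0
  have t3 := (tendsto_add_smul_arc A (rot s v) d hfc.continuousAt hf0).2
  have hcn : ∀ᶠ t in 𝓝 0, ⟪perpVec (arc v t), n⟫ ≠ 0 := by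
    have : Continuous fun t => ⟪perpVec (arc v t), n⟫ := by
      simp only [inner_eq_coord, perpVec_zero, perpVec_one, arc_zero_coord, arc_one_coord]
      fun_prop
    exact this.continuousAt.eventually_ne (by simpa using hn)
  have key : ∀ᶠ t in 𝓝 (0 : ℝ),
      ⟪A + f t • d + arc (rot s v) t - (A + rot s v), m⟫ = 0 := by
    filter_upwards [t1.eventually hA.eventually, t2.eventually h.eventually,
      t3.eventually hr.eventually, t3.eventually hm, hcn] with t a1 a2 a3 a4 a5
    have b1 := a1 (by rw [add_sub_cancel_left, real_inner_smul_left, hd, mul_zero])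
    have b2 := a2 (by
      have : f t * ⟪d, n⟫ = ⟪v - arc v t, n⟫ := div_mul_cancel₀ _ ha
      rw [show A + f t • d + arc v t - (A + v) = f t • d - (v - arc v t) by abel, inner_sub_left,
        real_inner_smul_left, this, sub_self])
    rw [← rot_arc] at a3 a4 ⊢
    obtain ⟨m', -, hm', -⟩ := hC.cross (b1.mem_closure_white he) (b1.mem_closure_black he)
      (norm_arc hv t) hs a3 b2 a5
    have hfr := hm'.mem_frontier
    rcases lt_trichotomy
      ⟪A + f t • d + rot s (arc v t) - (A + rot s v), m⟫ 0 with h0 | h0 | h0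
    · exact absurd hfr (notMem_frontier_of_mem_interior (a4.2.1 h0))
    · exact h0
    · rw [← frontier_compl] at hfr
      exact absurd hfr (notMem_frontier_of_mem_interior (a4.1 h0))
  have hneg : Tendsto (fun t : ℝ => -t) (𝓝 0) (𝓝 0) := by simpa using (continuous_neg.tendsto (0 : ℝ))
  obtain ⟨t, ⟨k1, k2⟩, ht⟩ := (((key.and (hneg.eventually key)).filter_mono
    nhdsWithin_le_nhds).and (Ioo_mem_nhdsGT (show (0 : ℝ) < 1 by norm_num))).exists
  have hS : sin t ≠ 0 := (sin_pos_of_pos_of_lt_pi ht.1 (by linarith [ht.2, pi_gt_three])).ne'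
  have hc : cos t - 1 ≠ 0 := by
    intro hc
    apply hS
    have := sin_sq_add_cos_sq t
    have h1 : cos t = 1 := by linarith
    rw [h1] at this
    nlinarith
  have g1 : f t * ⟪d, n⟫ = ⟪v - arc v t, n⟫ := div_mul_cancel₀ _ ha
  have g2 : f (-t) * ⟪d, n⟫ = ⟪v - arc v (-t), n⟫ := div_mul_cancel₀ _ ha
  clear_value f
  rw [norm_eq_one_iff_coord] at hv
  simp only [inner_eq_coord, PiLp.sub_apply, PiLp.add_apply, PiLp.smul_apply, smul_eq_mul,
    arc_zero_coord, arc_one_coord, rot_zero_coord, rot_one_coord, cos_neg, sin_neg] at *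
  set a := d 0 * n 0 + d 1 * n 1 with haa
  set b := d 0 * m 0 + d 1 * m 1 with hb
  set K0 := a * (1 / 2 * m 0 + s * m 1) - b * n 0 with hK0
  set K1 := a * (1 / 2 * m 1 - s * m 0) - b * n 1 with hK1
  have e1 : (cos t - 1) * (K0 * v 0 + K1 * v 1) + sin t * (K1 * v 0 - K0 * v 1) = 0 := by
    rw [hK0, hK1]; linear_combination a * k1 - b * g1
  have e2 : (cos t - 1) * (K0 * v 0 + K1 * v 1) - sin t * (K1 * v 0 - K0 * v 1) = 0 := by
    rw [hK0, hK1]; linear_combination a * k2 - b * g2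
  have e3 : K0 * v 0 + K1 * v 1 = 0 := by
    apply mul_left_cancel₀ hc; linear_combination (e1 + e2) / 2
  have e4 : K1 * v 0 - K0 * v 1 = 0 := by
    apply mul_left_cancel₀ hS; linear_combination (e1 - e2) / 2
  have e5 : K0 = 0 := by linear_combination v 0 * e3 - v 1 * e4 - K0 * hv
  have e6 : K1 = 0 := by linear_combination v 1 * e3 + v 0 * e4 - K1 * hv
  rw [hK0] at e5
  rw [hK1] at e6
  have f0 : a * m 0 = b * (1 / 2 * n 0 - s * n 1) := by
    linear_combination 1 / 2 * e5 - s * e6 - a * m 0 * hs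
  have f1 : a * m 1 = b * (1 / 2 * n 1 + s * n 0) := by
    linear_combination 1 / 2 * e6 + s * e5 - a * m 1 * hs
  have hb0 : b ≠ 0 := by
    intro hb0
    rw [hb0, zero_mul] at f0 f1
    exact hm0 (plane_ext ((mul_eq_zero.1 f0).resolve_left ha) ((mul_eq_zero.1 f1).resolve_left ha))
  apply mul_left_cancel₀ hb0
  linear_combination a * hb - d 0 * f0 - d 1 * f1

/-- If the unit circle around a boundary point meets the boundary transversally, the boundary
directions at the two points are parallel. -/
theorem C3.parallel (hC : C3 B) {d e : Plane} (hA : LocalHalf B A e) (he : e ≠ 0)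
    (hd : ⟪d, e⟫ = 0) (hv : ‖v‖ = 1) (h : LocalHalf B (A + v) n) (hn : ⟪perpVec v, n⟫ ≠ 0)
    (hs : s ^ 2 = 3 / 4) (hr : Regular B (A + rot s v)) (hr' : Regular B (A + rot (-s) v)) :
    ⟪d, n⟫ = 0 := by
  by_contra ha
  have h1 := hC.parallel_aux hA he hd hv h hn hs hr ha
  have h2 := hC.parallel_aux hA he hd hv h hn (by rwa [neg_sq]) hr' ha
  apply ha
  simp only [inner_eq_coord, rot_zero_coord, rot_one_coord] at h1 h2 ⊢
  linear_combination -h1 - h2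

theorem C3.tangent (hC : C3 B) {d e : Plane} (hA : LocalHalf B A e) (he : e ≠ 0)
    (hd : ⟪d, e⟫ = 0) (hv : ‖v‖ = 1) (h : LocalHalf B (A + v) n) (hn0 : n ≠ 0)
    (hn : ⟪perpVec v, n⟫ = 0)
    (hs : s ^ 2 = 3 / 4) (hr : Regular B (A + rot s v)) (hr' : Regular B (A + rot (-s) v)) :
    ⟪d, v⟫ = 0 := by
  by_contra hb
  set f : ℝ → ℝ := fun t => (1 - cos t) / ⟪d, v⟫ with hf
  have hfc : Continuous f := by fun_prop
  have hf0 : f 0 = 0 := by simp [hf]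
  obtain ⟨t1, t2⟩ := tendsto_add_smul_arc A v d hfc.continuousAt hf0
  have t3 := (tendsto_add_smul_arc A (rot s v) d hfc.continuousAt hf0).2
  have t4 := (tendsto_add_smul_arc A (rot (-s) v) d hfc.continuousAt hf0).2
  obtain ⟨t, ⟨a1, a2, a3, a4⟩, ht⟩ := ((((t1.eventually hA.eventually).and
    ((t2.eventually h.eventually).and ((t3.eventually hr.eventually).and
    (t4.eventually hr'.eventually)))).filter_mono
    nhdsWithin_le_nhds).and (Ioo_mem_nhdsGT (show (0 : ℝ) < 1 by norm_num))).exists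
  have hS : sin t ≠ 0 := (sin_pos_of_pos_of_lt_pi ht.1 (by linarith [ht.2, pi_gt_three])).ne'
  have g1 : f t * ⟪d, v⟫ = 1 - cos t := div_mul_cancel₀ _ hb
  have b1 := a1 (by rw [add_sub_cancel_left, real_inner_smul_left, hd, mul_zero])
  rw [← rot_arc] at a3 a4
  clear_value f
  have hv' := (norm_eq_one_iff_coord v).1 hv
  have hn' := hn
  simp only [inner_eq_coord, perpVec_zero, perpVec_one] at hn'
  have n0 : n 0 = ⟪v, n⟫ * v 0 := by
    rw [inner_eq_coord]; linear_combination -n 0 * hv' - v 1 * hn'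
  have n1 : n 1 = ⟪v, n⟫ * v 1 := by
    rw [inner_eq_coord]; linear_combination -n 1 * hv' + v 0 * hn'
  have hl : ⟪v, n⟫ ≠ 0 := by
    intro hl
    rw [hl, zero_mul] at n0 n1
    exact hn0 (plane_ext n0 n1)
  generalize ⟪v, n⟫ = l at n0 n1 hl
  have b2 := a2 (by
    rw [inner_eq_coord] at g1 ⊢
    simp only [PiLp.sub_apply, PiLp.add_apply, PiLp.smul_apply, smul_eq_mul,
      arc_zero_coord, arc_one_coord, n0, n1]
    linear_combination l * g1 + l * (cos t - 1) * hv')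
  have b3 := hC.parallel b1 he hd (norm_arc hv t) b2 (by
    have : ⟪perpVec (arc v t), n⟫ = -(sin t * l) := by
      rw [inner_eq_coord]
      simp only [perpVec_zero, perpVec_one, arc_zero_coord, arc_one_coord, n0, n1]
      linear_combination -(sin t * l) * hv'
    rw [this]
    exact neg_ne_zero.2 (mul_ne_zero hS hl)) hs a3 a4
  rw [inner_eq_coord, n0, n1] at b3
  rw [inner_eq_coord] at hb
  exact hb ((mul_eq_zero.1 (show l * (d 0 * v 0 + d 1 * v 1) = 0 by linear_combination b3)).resolve_left
    hl)

theorem C3.not_translate (hC : C3 B) {w : Plane} (hv : ‖v‖ = 1) (hs : s ^ 2 = 3 / 4)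
    (h0 : ∀ᶠ t : ℝ in 𝓝[>] 0, A + t • w ∈ interior Bᶜ)
    (h1 : ∀ᶠ t : ℝ in 𝓝[>] 0, A + v + t • w ∈ interior Bᶜ)
    (h2 : ∀ᶠ t : ℝ in 𝓝[>] 0, A + rot s v + t • w ∈ interior Bᶜ) : False := by
  obtain ⟨t, a0, a1, a2⟩ := (h0.and (h1.and h2)).exists
  rw [add_right_comm] at a1 a2
  exact hC.compl.not_mono (subset_closure a0) hv hs a1 a2

/-- The boundary cannot be tangent to the unit circle around `A` at `A + v` with white on the far
side, if the boundary direction at `A` is the same. -/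
theorem C3.not_tangent (hC : C3 B) {d : Plane} (hd : ‖d‖ = 1) (hA : LocalHalf B A (perpVec d))
    (hn : 0 < ⟪perpVec d, n⟫) (hv : ‖v‖ = 1) (h : LocalHalf B (A + v) n)
    (ht : ⟪perpVec v, n⟫ = 0) (hdv : ⟪d, v⟫ = 0) (hdn : ⟪v, n⟫ < 0)
    (hr : ∀ w : Plane, ‖w‖ = 1 → Regular B (A + w)) : False := by
  have hs : (√3 / 2) ^ 2 = 3 / 4 := by rw [div_pow, sq_sqrt] <;> norm_num
  have hs0 : √3 / 2 ≠ 0 := by positivity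
  generalize √3 / 2 = s at hs hs0
  have hw : ‖rot s v‖ = 1 := norm_rot hs hv
  have he : perpVec d ≠ 0 := by
    intro he
    rw [he, inner_zero_left] at hn
    exact hn.false
  have hde : ⟪d, perpVec d⟫ = 0 := by
    rw [inner_eq_coord, perpVec_zero, perpVec_one]; ring
  have hsw := h.arc_tangent ht hdn
  have b1 := hC.alternate (hA.mem_closure_white he) hv hs (hr _ hw) (Or.inl rfl)
    (hsw.filter_mono (nhdsWithin_mono _ fun t ht => ne_of_gt ht))
  have b2 := hC.alternate (hA.mem_closure_white he) hv hs (hr _ hw) (Or.inr rfl)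
    (hsw.filter_mono (nhdsWithin_mono _ fun t ht => ne_of_lt ht))
  have tt := tendsto_arc A (rot s v)
  have hi : A + rot s v ∈ interior B := by
    rcases hr _ hw with hi | ⟨m, hm0, hm⟩
    · refine (mem_interior_of_notMem_frontier hi).resolve_left fun hi => ?_
      obtain ⟨t, ht, ht'⟩ := (b1.and ((tt.eventually_mem (isOpen_interior.mem_nhds hi)).filter_mono
        nhdsWithin_le_nhds)).exists
      exact disjoint_interior_compl ht ht'
    · exfalso
      rcases (hm.color_change b1).lt_or_eq with h0 | h0
      · have := (hm.compl.arc_transversal (by rw [inner_neg_right]; linarith)).2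
        obtain ⟨t, ht, ht'⟩ := (b2.and this).exists
        exact disjoint_interior_compl ht ht'
      · have := hC.tangent hA he hde hw hm hm0 h0 hs (hr _ (norm_rot hs hw))
          (hr _ (norm_rot (by rwa [neg_sq]) hw))
        apply hs0
        have h2 : s * ⟪perpVec v, d⟫ = 0 := by
          rw [inner_eq_coord] at this hdv ⊢
          simp only [rot_zero_coord, rot_one_coord, perpVec_zero, perpVec_one] at this ⊢
          linear_combination this - hdv / 2
        refine (mul_eq_zero.1 h2).resolve_right fun h2 => ?_
        exact ne_zero_of_norm_eq_one hd (eq_zero_of_inner_eq_zero (ne_zero_of_norm_eq_one hv)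
          (by rwa [real_inner_comm]) h2)
  refine hC.compl.not_translate (A := A) (w := -perpVec d) hv hs ?_ ?_ ?_
  · refine hA.compl.eventually_white ?_
    rw [inner_neg_neg]
    exact inner_self_pos_of_ne_zero he
  · refine h.compl.eventually_white ?_
    rwa [inner_neg_neg]
  · rw [compl_compl]
    exact (tendsto_add_smul _ _).eventually_mem (isOpen_interior.mem_nhds hi)

theorem inner_sq_add (u : Plane) {d : Plane} (hu : ‖u‖ = 1) (hd : ‖d‖ = 1) :
    ⟪u, d⟫ ^ 2 + ⟪perpVec u, d⟫ ^ 2 = 1 := by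
  rw [norm_eq_one_iff_coord] at hu hd
  simp only [inner_eq_coord, perpVec_zero, perpVec_one]
  linear_combination (d 0 ^ 2 + d 1 ^ 2) * hu + hd

theorem inner_rot (s : ℝ) (u d : Plane) : ⟪rot s u, d⟫ = ⟪u, d⟫ / 2 + s * ⟪perpVec u, d⟫ := by
  simp only [inner_eq_coord, perpVec_zero, perpVec_one, rot_zero_coord, rot_one_coord]
  ring

/-- A vector orthogonal to the unit vector `d` is a multiple of `perpVec d`. -/
theorem inner_perpVec_of_orthogonal {d : Plane} (hd : ‖d‖ = 1) (h : ⟪d, n⟫ = 0) (w : Plane) :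
    ⟪perpVec w, n⟫ = ⟪perpVec d, n⟫ * ⟪w, d⟫ := by
  rw [norm_eq_one_iff_coord] at hd
  simp only [inner_eq_coord, perpVec_zero, perpVec_one] at *
  linear_combination (w 1 * n 0 - w 0 * n 1) * hd + (-w 1 * d 0 + w 0 * d 1) * h

theorem inner_perpVec_ne_zero {d : Plane} (hd : ‖d‖ = 1) (hn : n ≠ 0) (h : ⟪d, n⟫ = 0) :
    ⟪perpVec d, n⟫ ≠ 0 :=
  fun h' => hn (eq_zero_of_inner_eq_zero (ne_zero_of_norm_eq_one hd) h h')

theorem perpVec_ne_zero {d : Plane} (hd : ‖d‖ = 1) : perpVec d ≠ 0 := by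
  apply ne_zero_of_norm_eq_one
  rw [norm_eq_one_iff_coord] at *
  simp only [perpVec_zero, perpVec_one]
  linear_combination hd

theorem inner_perpVec_self (d : Plane) : ⟪d, perpVec d⟫ = 0 := by
  rw [inner_eq_coord, perpVec_zero, perpVec_one]; ring

theorem C3.opposite (hC : C3 B) {d u : Plane} (hd : ‖d‖ = 1) (hA : LocalHalf B A (perpVec d))
    (hr : ∀ w : Plane, ‖w‖ = 1 → Regular B (A + w)) (hu : ‖u‖ = 1) (hn0 : n ≠ 0)
    (h : LocalHalf B (A + u) n) (hud : ⟪u, d⟫ ^ 2 < 3 / 4) :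
    ⟪d, n⟫ = 0 ∧ ⟪perpVec d, n⟫ < 0 := by
  have hs : (√3 / 2) ^ 2 = 3 / 4 := by rw [div_pow, sq_sqrt] <;> norm_num
  have hs0 : 0 < √3 / 2 := by positivity
  generalize √3 / 2 = s at hs hs0
  have he := perpVec_ne_zero hd
  have hde := inner_perpVec_self d
  have hxy := inner_sq_add u hu hd
  have rr : ∀ v : Plane, ‖v‖ = 1 → ∀ s : ℝ, s ^ 2 = 3 / 4 → Regular B (A + rot s v) :=
    fun v hv s hs => hr _ (norm_rot hs hv)
  have hs' : (-s) ^ 2 = 3 / 4 := by rwa [neg_sq]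
  by_cases ht : ⟪perpVec u, n⟫ = 0
  · have hdu := hC.tangent hA he hde hu h hn0 ht hs (rr u hu s hs) (rr u hu _ hs')
    have hdn : ⟪d, n⟫ = 0 := by
      rw [norm_eq_one_iff_coord] at hu
      rw [inner_eq_coord] at hdu ht ⊢
      simp only [perpVec_zero, perpVec_one] at ht
      linear_combination (u 0 * n 0 + u 1 * n 1) * hdu + (u 0 * d 1 - u 1 * d 0) * ht -
        (d 0 * n 0 + d 1 * n 1) * hu
    refine ⟨hdn, not_le.1 fun hpos => ?_⟩
    have hpos := hpos.lt_of_ne' (inner_perpVec_ne_zero hd hn0 hdn)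
    have hun : ⟪u, n⟫ ≠ 0 := fun h0 => hn0 (eq_zero_of_inner_eq_zero (ne_zero_of_norm_eq_one hu) h0 ht)
    rcases lt_or_gt_of_ne hun with h0 | h0
    · exact hC.not_tangent hd hA hpos hu h ht hdu h0 hr
    · have hneg : perpVec (-d) = -perpVec d := by apply plane_ext <;> simp
      refine hC.compl.not_tangent (d := -d) (n := -n) (by rwa [norm_neg]) ?_ ?_ hu h.compl ?_ ?_ ?_
        fun w hw => (hr w hw).compl
      · rw [hneg]; exact hA.compl
      · rwa [hneg, inner_neg_neg]
      · rw [inner_neg_right, ht, neg_zero]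
      · rw [inner_neg_left, hdu, neg_zero]
      · rw [inner_neg_right]; linarith
  · have hdn := hC.parallel hA he hde hu h ht hs (rr u hu s hs) (rr u hu _ hs')
    refine ⟨hdn, not_le.1 fun hpos => ?_⟩
    have hpos := hpos.lt_of_ne' (inner_perpVec_ne_zero hd hn0 hdn)
    have e1 := inner_perpVec_of_orthogonal hd hdn u
    have hx : ⟪u, d⟫ ≠ 0 := fun hx => ht (by rw [e1, hx, mul_zero])
    obtain ⟨r, hrs, hrneg⟩ : ∃ r : ℝ, r ^ 2 = 3 / 4 ∧ ⟪rot r u, d⟫ * ⟪u, d⟫ < 0 := by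
      simp only [inner_rot]
      generalize ⟪u, d⟫ = x at *
      generalize ⟪perpVec u, d⟫ = y at *
      have hx2 : 0 < x ^ 2 := by positivity
      have hlt : (x ^ 2 / 2) ^ 2 < (s * (x * y)) ^ 2 := by
        have hy : y ^ 2 = 1 - x ^ 2 := by linarith
        rw [mul_pow, mul_pow, hs, hy]
        nlinarith
      have := sq_lt_sq.1 hlt
      rw [abs_of_pos (by positivity)] at this
      rcases lt_abs.1 this with h1 | h1
      · exact ⟨-s, hs', by linarith⟩
      · exact ⟨s, hs, by linarith⟩
    obtain ⟨m, hm0, hm, hlt⟩ := hC.cross (hA.mem_closure_white he) (hA.mem_closure_black he) hu hrs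
      (rr u hu r hrs) h ht
    have hw := norm_rot hrs hu
    have hdm := hC.parallel hA he hde hw hm (right_ne_zero_of_mul hlt.ne) hs
      (rr _ hw s hs) (rr _ hw _ hs')
    have e2 := inner_perpVec_of_orthogonal hd hdm (rot r u)
    rw [e1, e2] at hlt
    have hmpos : 0 < ⟪perpVec d, m⟫ := by
      by_contra! hc
      have := mul_nonneg (mul_nonneg hpos.le (neg_nonneg.2 hc)) (neg_pos.2 hrneg).le
      linarith
    exact hC.not_translate hu hrs (hA.eventually_white (inner_self_pos_of_ne_zero he))
      (h.eventually_white hpos) (hm.eventually_white hmpos)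

theorem C3.same (hC : C3 B) {d u : Plane} (hd : ‖d‖ = 1) (hA : LocalHalf B A (perpVec d))
    (hr : ∀ w : Plane, ‖w‖ = 1 → Regular B (A + w)) (hu : ‖u‖ = 1) (hn0 : n ≠ 0)
    (h : LocalHalf B (A + u) n) (hud : 3 / 4 < ⟪u, d⟫ ^ 2) :
    ⟪d, n⟫ = 0 ∧ 0 < ⟪perpVec d, n⟫ := by
  have hs : (√3 / 2) ^ 2 = 3 / 4 := by rw [div_pow, sq_sqrt] <;> norm_num
  generalize √3 / 2 = s at hs
  have he := perpVec_ne_zero hd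
  have hde := inner_perpVec_self d
  have hxy := inner_sq_add u hu hd
  have hw := norm_rot hs hu
  have hr1 := hr _ hw
  have hr2 := hr _ (norm_rot (show (-s) ^ 2 = 3 / 4 by rwa [neg_sq]) hu)
  have ht : ⟪perpVec u, n⟫ ≠ 0 := by
    intro ht
    have := hC.tangent hA he hde hu h hn0 ht hs hr1 hr2
    rw [real_inner_comm, this] at hud
    norm_num at hud
  have hdn := hC.parallel hA he hde hu h ht hs hr1 hr2
  refine ⟨hdn, ?_⟩
  obtain ⟨m, hm0, hm, hlt⟩ := hC.cross (hA.mem_closure_white he) (hA.mem_closure_black he) hu hs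
    hr1 h ht
  have hlt2 : (s * (⟪u, d⟫ * ⟪perpVec u, d⟫)) ^ 2 < (3 / 8) ^ 2 := by
    generalize ⟪u, d⟫ = x at *
    generalize ⟪perpVec u, d⟫ = y at *
    have hy : y ^ 2 = 1 - x ^ 2 := by linarith
    rw [mul_pow, mul_pow, hs, hy]
    nlinarith [sq_pos_of_pos (sub_pos.2 hud)]
  have hab := abs_lt_of_sq_lt_sq' hlt2 (by norm_num)
  obtain ⟨hdm, hmneg⟩ := hC.opposite hd hA hr hw hm0 hm (by
    rw [inner_rot]
    nlinarith)
  have e1 := inner_perpVec_of_orthogonal hd hdn u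
  have e2 := inner_perpVec_of_orthogonal hd hdm (rot s u)
  have hpos : 0 < ⟪u, d⟫ * ⟪rot s u, d⟫ := by
    rw [inner_rot]
    nlinarith
  rw [e1, e2] at hlt
  by_contra! hc
  have := mul_nonneg (mul_nonneg (neg_nonneg.2 hc) (neg_pos.2 hmneg).le) hpos.le
  linarith

theorem halfBall_subset {ε : ℝ}
    (h : ∀ q ∈ frontier B ∩ Metric.ball p ε, ⟪q - p, n⟫ = 0) :
    Metric.ball p ε ∩ {q | 0 < ⟪q - p, n⟫} ⊆ interior B ∨
      Metric.ball p ε ∩ {q | 0 < ⟪q - p, n⟫} ⊆ interior Bᶜ := by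
  set H := Metric.ball p ε ∩ {q | 0 < ⟪q - p, n⟫} with hH
  have hconv : Convex ℝ H := by
    refine (convex_ball p ε).inter ?_
    intro x hx y hy a b ha hb hab
    simp only [Set.mem_ofPred_eq] at *
    have : a • x + b • y - p = a • (x - p) + b • (y - p) := by
      rw [smul_sub, smul_sub, sub_add_sub_comm, ← add_smul, hab, one_smul]
    rw [this, inner_add_left, real_inner_smul_left, real_inner_smul_left]
    rcases ha.eq_or_lt with rfl | ha
    · rw [zero_add] at hab; simp [hab, hy]
    · have := mul_pos ha hx
      have := mul_nonneg hb hy.le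
      linarith
  have hcover : ∀ q ∈ H, q ∈ interior B ∨ q ∈ interior Bᶜ := fun q hq =>
    (mem_interior_of_notMem_frontier fun hf => (ne_of_gt hq.2) (h q ⟨hf, hq.1⟩)).symm
  by_contra! hc
  obtain ⟨⟨x, hx, hxB⟩, y, hy, hyB⟩ := And.imp Set.not_subset.1 Set.not_subset.1 hc
  obtain ⟨z, -, hz⟩ := hconv.isPreconnected _ _ isOpen_interior isOpen_interior hcover
    ⟨y, hy, (hcover y hy).resolve_right hyB⟩ ⟨x, hx, (hcover x hx).resolve_left hxB⟩
  exact disjoint_interior_compl hz.1 hz.2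

theorem LocalHalf.of_halfBalls {ε : ℝ} (hn : n ≠ 0) (hε : 0 < ε)
    (hW : Metric.ball p ε ∩ {q | 0 < ⟪q - p, n⟫} ⊆ interior Bᶜ)
    (hB : Metric.ball p ε ∩ {q | 0 < ⟪q - p, -n⟫} ⊆ interior B) : LocalHalf B p n := by
  have hnear : ∀ q ∈ Metric.ball p ε, ⟪q - p, n⟫ = 0 → ∀ m : Plane,
      ∃ᶠ x in 𝓝 q, x ∈ Metric.ball p ε ∧ (0 < ⟪m, n⟫ → 0 < ⟪x - p, n⟫) ∧
        (⟪m, n⟫ < 0 → 0 < ⟪x - p, -n⟫) := by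
    intro q hq h0 m
    refine (tendsto_add_smul q m).frequently (Eventually.frequently ?_)
    filter_upwards [(tendsto_add_smul q m).eventually_mem (Metric.isOpen_ball.mem_nhds hq),
      self_mem_nhdsWithin] with t ht ht0
    have : ⟪q + t • m - p, n⟫ = t * ⟪m, n⟫ := by
      rw [add_sub_right_comm, inner_add_left, h0, zero_add, real_inner_smul_left]
    rw [inner_neg_right, this]
    exact ⟨ht, fun h => mul_pos ht0 h, fun h => neg_pos.2 (mul_neg_of_pos_of_neg ht0 h)⟩
  have hpos := inner_self_pos_of_ne_zero hn
  filter_upwards [Metric.ball_mem_nhds p hε] with q hq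
  refine ⟨fun h => hW ⟨hq, h⟩, fun h => hB ⟨hq, ?_⟩, fun h => ?_⟩
  · change 0 < ⟪q - p, -n⟫
    rw [inner_neg_right]
    linarith
  · rw [frontier_eq_closure_inter_closure]
    constructor
    · refine mem_closure_iff_frequently.2 ((hnear q hq h (-n)).mono fun x hx => ?_)
      exact interior_subset (hB ⟨hx.1, hx.2.2 (by rw [inner_neg_left]; linarith)⟩)
    · refine mem_closure_iff_frequently.2 ((hnear q hq h n).mono fun x hx => ?_)
      exact interior_subset (hW ⟨hx.1, hx.2.1 hpos⟩)

theorem OrientedDir.localHalf {d : Plane} (h : OrientedDir B p d) :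
    LocalHalf B p (perpVec d) := by
  obtain ⟨hd, ε, hε, hline, hcol⟩ := h
  have he := perpVec_ne_zero hd
  have hpos := inner_self_pos_of_ne_zero he
  have h0 : ∀ q ∈ frontier B ∩ Metric.ball p ε, ⟪q - p, perpVec d⟫ = 0 := by
    intro q hq
    obtain ⟨t, rfl⟩ := hline q hq
    rw [add_sub_cancel_left, real_inner_smul_left, inner_perpVec_self, mul_zero]
  have hball : ∀ m : Plane, ∀ᶠ t : ℝ in 𝓝[>] 0, p + t • m ∈ Metric.ball p ε := fun m =>
    (tendsto_add_smul p m).eventually_mem (Metric.ball_mem_nhds p hε)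
  obtain ⟨t, ht, htb, htb'⟩ := ((eventually_mem_set.2 (Ioo_mem_nhdsGT hε)).and
    ((hball (perpVec d)).and (hball (-perpVec d)))).exists
  obtain ⟨c1, c2⟩ := hcol t ht.1 ht.2
  rw [sub_eq_add_neg, ← smul_neg] at c2
  refine LocalHalf.of_halfBalls he hε ?_ ?_
  · refine (halfBall_subset h0).resolve_left fun hc => ?_
    refine disjoint_interior_compl (hc ⟨htb, ?_⟩) c1
    change 0 < ⟪p + t • perpVec d - p, perpVec d⟫
    rw [add_sub_cancel_left, real_inner_smul_left]
    exact mul_pos ht.1 hpos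
  · refine (halfBall_subset (n := -perpVec d) fun q hq => ?_).resolve_right fun hc => ?_
    · rw [inner_neg_right, h0 q hq, neg_zero]
    refine disjoint_interior_compl c2 (hc ⟨htb', ?_⟩)
    change 0 < ⟪p + t • -perpVec d - p, -perpVec d⟫
    rw [add_sub_cancel_left, real_inner_smul_left, inner_neg_neg]
    exact mul_pos ht.1 hpos

/-- If the complement of `B` has no thin parts and `B` covers both sides of a line near `p`, then
`p` is interior to `B`. -/
theorem notMem_frontier_of_halfBalls {ε : ℝ} (hn : n ≠ 0) (hε : 0 < ε)
    (hsub : Bᶜ ⊆ closure (interior Bᶜ))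
    (h1 : Metric.ball p ε ∩ {q | 0 < ⟪q - p, n⟫} ⊆ interior B)
    (h2 : Metric.ball p ε ∩ {q | 0 < ⟪q - p, -n⟫} ⊆ interior B) : p ∉ frontier B := by
  refine notMem_frontier_of_mem_interior (mem_interior.2
    ⟨_, fun q hq => ?_, Metric.isOpen_ball, Metric.mem_ball_self hε⟩)
  by_contra hqB
  have hopen : IsOpen (Metric.ball p ε ∩ interior Bᶜ) := Metric.isOpen_ball.inter isOpen_interior
  obtain ⟨x, hxW, hxb⟩ := ((mem_closure_iff_frequently.1 (hsub hqB)).and_eventually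
    (Metric.isOpen_ball.mem_nhds hq)).exists
  have hx : ⟪x - p, n⟫ = 0 := by
    rcases lt_trichotomy ⟪x - p, n⟫ 0 with h | h | h
    · refine (disjoint_interior_compl (h2 ⟨hxb, ?_⟩) hxW).elim
      change 0 < ⟪x - p, -n⟫
      rw [inner_neg_right]
      linarith
    · exact h
    · exact (disjoint_interior_compl (h1 ⟨hxb, h⟩) hxW).elim
  obtain ⟨t, ⟨htb, htW⟩, ht⟩ := (((tendsto_add_smul x n).eventually_mem
    (hopen.mem_nhds ⟨hxb, hxW⟩)).and self_mem_nhdsWithin).exists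
  refine disjoint_interior_compl (h1 ⟨htb, ?_⟩) htW
  change 0 < ⟪x + t • n - p, n⟫
  rw [add_sub_right_comm, inner_add_left, hx, zero_add, real_inner_smul_left]
  exact mul_pos ht (inner_self_pos_of_ne_zero hn)

theorem IsSeg.exists_normal {σ : Set Plane} (h : IsSeg σ) (hp : p ∈ σ) :
    ∃ n : Plane, n ≠ 0 ∧ ∀ q ∈ σ, ⟪q - p, n⟫ = 0 := by
  obtain ⟨-, -, -, l, ⟨-, hl⟩, hσ⟩ := h
  obtain ⟨w, hw, hspan⟩ := finrank_eq_one_iff'.1 hl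
  have hw' : (w : Plane) ≠ 0 := fun h => hw (Subtype.ext h)
  refine ⟨perpVec w, fun h => hw' ?_, fun q hq => ?_⟩
  · have h0 := congrArg (fun x : Plane => x 0) h
    have h1 := congrArg (fun x : Plane => x 1) h
    simp only [perpVec_zero, perpVec_one, PiLp.zero_apply, neg_eq_zero] at h0 h1
    exact plane_ext h1 h0
  · obtain ⟨c, hc⟩ := hspan ⟨q - p, l.vsub_mem_direction (hσ hq) (hσ hp)⟩
    have hc : c • (w : Plane) = q - p := congrArg Subtype.val hc
    rw [← hc, real_inner_smul_left, inner_perpVec_self, mul_zero]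

theorem IsPolygonal.regular {S : Set (Set Plane)} (h : IsPolygonal B S) (hp : ¬IsVertex S p) :
    Regular B p := by
  by_cases hpf : p ∈ frontier B
  swap
  · exact Or.inl hpf
  right
  obtain ⟨σ, hσ, hpσ⟩ : ∃ σ ∈ S, p ∈ σ := by rwa [h.boundary] at hpf
  obtain ⟨n, hn, hline⟩ := (h.seg σ hσ).exists_normal hpσ
  have hfin : {τ ∈ S | (τ ∩ Metric.ball p 1).Nonempty ∧ τ ≠ σ}.Finite :=
    (h.loc_finite _ Metric.isBounded_ball).subset fun τ hτ => ⟨hτ.1, hτ.2.1⟩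
  have hclosed : IsClosed (⋃ τ ∈ {τ ∈ S | (τ ∩ Metric.ball p 1).Nonempty ∧ τ ≠ σ}, τ) :=
    hfin.isClosed_biUnion fun τ hτ => (h.seg τ hτ.1).1
  have hpn : p ∉ ⋃ τ ∈ {τ ∈ S | (τ ∩ Metric.ball p 1).Nonempty ∧ τ ≠ σ}, τ := by
    simp only [Set.mem_iUnion, not_exists]
    intro τ hτ hpτ
    exact hp ⟨τ, hτ.1, (h.inter_endpoint τ hτ.1 σ hσ hτ.2.2 p ⟨hpτ, hpσ⟩).1⟩
  obtain ⟨ε, hε, hsub⟩ := Metric.mem_nhds_iff.1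
    (inter_mem (Metric.ball_mem_nhds p one_pos) (hclosed.isOpen_compl.mem_nhds hpn))
  have h0 : ∀ q ∈ frontier B ∩ Metric.ball p ε, ⟪q - p, n⟫ = 0 := by
    rintro q ⟨hq, hqε⟩
    rw [h.boundary] at hq
    obtain ⟨τ, hτ, hqτ⟩ := hq
    refine hline q ?_
    by_contra hqσ
    refine (hsub hqε).2 (Set.mem_biUnion (x := τ) ⟨hτ, ⟨q, hqτ, (hsub hqε).1⟩, ?_⟩ hqτ)
    rintro rfl
    exact hqσ hqτ
  have h0' : ∀ q ∈ frontier B ∩ Metric.ball p ε, ⟪q - p, -n⟫ = 0 := fun q hq => by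
    rw [inner_neg_right, h0 q hq, neg_zero]
  have hn' := neg_ne_zero.2 hn
  rcases halfBall_subset h0 with h1 | h1 <;> rcases halfBall_subset h0' with h2 | h2
  · exact absurd hpf (notMem_frontier_of_halfBalls hn hε h.white_sub h1 h2)
  · exact ⟨-n, hn', .of_halfBalls hn' hε h2 (by rwa [neg_neg])⟩
  · exact ⟨n, hn, .of_halfBalls hn hε h1 h2⟩
  · rw [← frontier_compl] at hpf
    exact absurd hpf (notMem_frontier_of_halfBalls hn hε
      (by rw [compl_compl]; exact h.black_sub) h1 h2)

theorem eq_smul_of_inner_perpVec_eq_zero {d d' : Plane} (hd : ‖d‖ = 1)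
    (h : ⟪d, perpVec d'⟫ = 0) : d' = ⟪perpVec d, perpVec d'⟫ • d := by
  rw [norm_eq_one_iff_coord] at hd
  simp only [inner_eq_coord, perpVec_zero, perpVec_one] at *
  apply plane_ext <;> simp only [PiLp.smul_apply, smul_eq_mul]
  · linear_combination -d' 0 * hd + d 1 * h
  · linear_combination -d' 1 * hd - d 0 * h

theorem eq_one_or_eq_neg_one_of_smul {d d' : Plane} {c : ℝ} (hd : ‖d‖ = 1) (hd' : ‖d'‖ = 1)
    (h : d' = c • d) : c = 1 ∨ c = -1 := by
  rw [h, norm_smul, hd, mul_one, Real.norm_eq_abs] at hd'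
  exact eq_or_eq_neg_of_abs_eq hd'

end

theorem stmt19 (B : Set (EuclideanSpace ℝ (Fin 2))) (S : Set (Set (EuclideanSpace ℝ (Fin 2))))
    (hpoly : IsPolygonal B S) (hC3 : C3 B)
    (A : EuclideanSpace ℝ (Fin 2)) (hA : Feasible B S A)
    (d : EuclideanSpace ℝ (Fin 2)) (hd : OrientedDir B A d)
    (u : EuclideanSpace ℝ (Fin 2)) (hu : ‖u‖ = 1) (hAu : A + u ∈ frontier B)
    (d' : EuclideanSpace ℝ (Fin 2)) (hd' : OrientedDir B (A + u) d') :
    (|⟪u, d⟫| < Real.sqrt 3 / 2 → d' = -d) ∧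
    (Real.sqrt 3 / 2 < |⟪u, d⟫| → d' = d) := by
  have hr : ∀ w : Plane, ‖w‖ = 1 → Regular B (A + w) := fun w hw =>
    hpoly.regular (hA.2.2 _ (by simp [hw]))
  have hsq : (√3 / 2) ^ 2 = 3 / 4 := by rw [div_pow, sq_sqrt] <;> norm_num
  have hpos : 0 < √3 / 2 := by positivity
  have he' := perpVec_ne_zero hd'.1
  constructor
  · intro h
    obtain ⟨h0, hneg⟩ := hC3.opposite hd.1 hd.localHalf hr hu he' hd'.localHalf
      (by rw [← hsq, sq_lt_sq, abs_of_pos hpos]; exact h)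
    have heq := eq_smul_of_inner_perpVec_eq_zero hd.1 h0
    rcases eq_one_or_eq_neg_one_of_smul hd.1 hd'.1 heq with h1 | h1
    · linarith
    · rw [heq, h1, neg_one_smul]
  · intro h
    obtain ⟨h0, hpos⟩ := hC3.same hd.1 hd.localHalf hr hu he' hd'.localHalf
      (by rw [← hsq, sq_lt_sq, abs_of_pos hpos]; exact h)
    have heq := eq_smul_of_inner_perpVec_eq_zero hd.1 h0
    rcases eq_one_or_eq_neg_one_of_smul hd.1 hd'.1 heq with h1 | h1
    · rw [heq, h1, one_smul]
    · linarith

end
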